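/- arXiv:1903.10455 — 2 statements merged into one kernel-verified Lean document; each statement's English description precedes it below -/
import Mathlib

section
/- Let μ be a Borel probability measure on [0,1] and A a positive definite n×n complex matrix, and define F_{μ,A}(X) = A σ_μ X on positive definite n×n complex matrices. Then for every positive definite X and Hermitian Y, D F_{μ,A}(X)[Y] = ∫_{[0,1]} λ ((1-λ)X A^{-1} + λI)^{-1} Y ((1-λ)A^{-1}X + λI)^{-1} dμ(λ). -/
open MeasureTheory Matrix
open scoped ComplexOrder

/-- `f_μ(x) = ∫_{[0,1]} x / ((1-λ)x + λ) dμ(λ)`. -/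
noncomputable def fmu (μ : Measure ℝ) (x : ℝ) : ℝ := ∫ l, x / ((1 - l) * x + l) ∂μ

/-- The center of mass `c(μ) = ∫_{[0,1]} λ dμ(λ)`. -/
noncomputable def cmu (μ : Measure ℝ) : ℝ := ∫ l, l ∂μ

/-- The positive square root of a positive definite matrix, via functional calculus. -/
noncomputable def matSqrt {n : ℕ} (A : Matrix (Fin n) (Fin n) ℂ) : Matrix (Fin n) (Fin n) ℂ :=
  cfc Real.sqrt A

/-- The Kubo–Ando mean `A σ_μ B = A^{1/2} f_μ(A^{-1/2} B A^{-1/2}) A^{1/2}`. -/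
noncomputable def kuboAndo {n : ℕ} (μ : Measure ℝ) (A B : Matrix (Fin n) (Fin n) ℂ) :
    Matrix (Fin n) (Fin n) ℂ :=
  matSqrt A * cfc (fmu μ) ((matSqrt A)⁻¹ * B * (matSqrt A)⁻¹) * matSqrt A

/-- The generalized quantum Hellinger divergence
`φ_μ(A,B) = Tr((1-c(μ))A + c(μ)B - A σ_μ B)`. -/
noncomputable def qhd {n : ℕ} (μ : Measure ℝ) (A B : Matrix (Fin n) (Fin n) ℂ) : ℝ :=
  (((1 - cmu μ) • A + cmu μ • B - kuboAndo μ A B).trace).re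

attribute [local instance] Matrix.frobeniusNormedAddCommGroup Matrix.frobeniusNormedSpace

open Filter Topology

theorem restrict_of_measure_eq_one {μ : Measure ℝ} [IsProbabilityMeasure μ] {s : Set ℝ}
    (hs : MeasurableSet s) (h : μ s = 1) : μ.restrict s = μ :=
  Measure.restrict_eq_self_of_ae_mem ((prob_compl_eq_zero_iff hs).2 h)

theorem integrable_of_continuousOn {E : Type*} [NormedAddCommGroup E] {μ : Measure ℝ}
    [IsProbabilityMeasure μ] {K : Set ℝ} (hK : IsCompact K) (h : μ K = 1) {f : ℝ → E}
    (hf : ContinuousOn f K) : Integrable f μ := by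
  rw [← restrict_of_measure_eq_one hK.measurableSet h]
  exact hf.integrableOn_compact hK

/-- Differentiation under the integral sign for an integrand whose derivative is jointly continuous
over a compact set carrying the measure. -/
theorem hasDerivAt_integral_of_continuousOn {E : Type*} [NormedAddCommGroup E] [NormedSpace ℝ E]
    {μ : Measure ℝ} [IsProbabilityMeasure μ] {K : Set ℝ} (hK : IsCompact K) (h : μ K = 1)
    {F F' : ℝ → ℝ → E} {t₀ δ : ℝ} (hδ : 0 < δ)
    (hF : ContinuousOn (Function.uncurry F) (Metric.closedBall t₀ δ ×ˢ K))
    (hF' : ContinuousOn (Function.uncurry F') (Metric.closedBall t₀ δ ×ˢ K))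
    (hd : ∀ t ∈ Metric.closedBall t₀ δ, ∀ l ∈ K, HasDerivAt (F · l) (F' t l) t) :
    HasDerivAt (fun t => ∫ l, F t l ∂μ) (∫ l, F' t₀ l ∂μ) t₀ := by
  have hint {G : ℝ → ℝ → E}
      (hG : ContinuousOn (Function.uncurry G) (Metric.closedBall t₀ δ ×ˢ K)) {t : ℝ}
      (ht : t ∈ Metric.closedBall t₀ δ) : Integrable (G t) μ :=
    integrable_of_continuousOn hK h
      (hG.comp (f := fun l => (t, l)) (by fun_prop) fun l hl => ⟨ht, hl⟩)
  have h0 : t₀ ∈ Metric.closedBall t₀ δ := Metric.mem_closedBall_self hδ.le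
  obtain ⟨C, hC⟩ := ((isCompact_closedBall t₀ δ).prod hK).exists_bound_of_continuousOn hF'
  have hae : ∀ᵐ l ∂μ, l ∈ K := (prob_compl_eq_zero_iff hK.measurableSet).2 h
  have hnhds := Metric.closedBall_mem_nhds t₀ hδ
  exact (hasDerivAt_integral_of_dominated_loc_of_deriv_le (bound := fun _ => C) hnhds
    (eventually_of_mem hnhds fun t ht => (hint hF ht).aestronglyMeasurable) (hint hF h0)
    (hint hF' h0).aestronglyMeasurable (hae.mono fun l hl t ht => hC (t, l) ⟨ht, hl⟩)
    (integrable_const C) (hae.mono fun l hl t ht => hd t ht l hl)).2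

section PosDef

variable {m : Type*}

/-- Positive definiteness persists under small Hermitian perturbations. -/
theorem Matrix.PosDef.eventually_add_smul [Fintype m] {X Y : Matrix m m ℂ} (hX : X.PosDef)
    (hY : Y.IsHermitian) : ∀ᶠ t : ℝ in 𝓝 0, (X + t • Y).PosDef := by
  have hH (t : ℝ) : (X + t • Y).IsHermitian :=
    hX.isHermitian.add (hY.smul (IsSelfAdjoint.all t))
  have key : ∀ᶠ t : ℝ in 𝓝 0, ∀ x ∈ Metric.sphere (0 : m → ℂ) 1,
      0 < (star x ⬝ᵥ ((X + t • Y) *ᵥ x)).re := by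
    refine (isCompact_sphere (0 : m → ℂ) 1).eventually_forall_of_forall_eventually
      (P := fun (t : ℝ) (x : m → ℂ) => 0 < (star x ⬝ᵥ ((X + t • Y) *ᵥ x)).re) fun x hx => ?_
    have hx0 : x ≠ 0 := by
      rintro rfl
      simp at hx
    have hc : Continuous fun z : ℝ × (m → ℂ) =>
        (star z.2 ⬝ᵥ ((X + z.1 • Y) *ᵥ z.2)).re := by
      refine Complex.continuous_re.comp ?_
      refine Continuous.dotProduct (continuous_snd.star) ?_
      refine Continuous.matrix_mulVec ?_ continuous_snd
      exact continuous_const.add (continuous_fst.smul continuous_const)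
    refine hc.continuousAt.eventually_const_lt ?_
    simpa using hX.re_dotProduct_pos hx0
  filter_upwards [key] with t ht
  refine .of_dotProduct_mulVec_pos (hH t) fun x hx => ?_
  have hn : 0 < ‖x‖ := norm_pos_iff.2 hx
  have h1 := ht (‖x‖⁻¹ • x) (by simp [norm_smul, hn.ne'])
  rw [Complex.pos_iff]
  refine ⟨?_, ((hH t).im_star_dotProduct_mulVec_self x).symm⟩
  rw [mulVec_smul, star_smul, smul_dotProduct, dotProduct_smul] at h1
  simp only [star_trivial, Complex.smul_re, smul_eq_mul] at h1
  exact pos_of_mul_pos_right (pos_of_mul_pos_right h1 (by positivity)) (by positivity)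

theorem Matrix.PosDef.convex_combination {X A : Matrix m m ℂ} (hX : X.PosDef) (hA : A.PosDef)
    {l : ℝ} (hl : l ∈ Set.Icc (0 : ℝ) 1) : ((1 - l) • X + l • A).PosDef := by
  rcases hl.1.eq_or_lt with rfl | h0
  · simpa using hX
  rcases hl.2.eq_or_lt with rfl | h1
  · simpa using hA
  exact (hX.smul (sub_pos.2 h1)).add (hA.smul h0)

end PosDef

section

variable {n : ℕ}

theorem matSqrt_isHermitian (A : Matrix (Fin n) (Fin n) ℂ) : (matSqrt A).IsHermitian :=
  cfc_predicate Real.sqrt A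

theorem matSqrt_mul_self {A : Matrix (Fin n) (Fin n) ℂ} (hA : A.PosDef) :
    matSqrt A * matSqrt A = A := by
  unfold matSqrt
  rw [← cfc_mul Real.sqrt Real.sqrt A]
  conv_rhs => rw [← cfc_id ℝ A hA.1.isSelfAdjoint]
  refine cfc_congr fun x hx => ?_
  rw [hA.isHermitian.spectrum_real_eq_range_eigenvalues] at hx
  obtain ⟨i, rfl⟩ := hx
  exact Real.mul_self_sqrt (hA.eigenvalues_pos i).le

theorem isUnit_matSqrt {A : Matrix (Fin n) (Fin n) ℂ} (hA : A.PosDef) : IsUnit (matSqrt A) :=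
  isUnit_of_mul_isUnit_left ((matSqrt_mul_self hA).symm ▸ hA.isUnit)

/-- Simultaneous diagonalization by congruence of two positive definite matrices, compatible with
the Kubo–Ando mean. -/
theorem kuboAndo_exists_congruence {A X : Matrix (Fin n) (Fin n) ℂ} (hA : A.PosDef)
    (hX : X.PosDef) : ∃ (P R : Matrix (Fin n) (Fin n) ℂ) (d : Fin n → ℝ),
      IsUnit P ∧ IsUnit R ∧ (∀ i, 0 < d i) ∧ A = P * R ∧
      X = P * diagonal (fun i => (d i : ℂ)) * R ∧
      ∀ μ : Measure ℝ, kuboAndo μ A X = P * diagonal (fun i => (fmu μ (d i) : ℂ)) * R := by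
  have hS := isUnit_matSqrt hA
  have hSd := (isUnit_iff_isUnit_det _).1 hS
  have hSh := matSqrt_isHermitian A
  have hSS := matSqrt_mul_self hA
  set S := matSqrt A with hSdef
  have hSi : IsUnit S⁻¹ := isUnit_nonsing_inv_iff.2 hS
  have hZ : (S⁻¹ * X * S⁻¹).PosDef := by
    have := (IsUnit.posDef_star_right_conjugate_iff hSi).2 hX
    rwa [star_eq_conjTranspose, hSh.inv.eq] at this
  have hc (f : ℝ → ℝ) : cfc f (S⁻¹ * X * S⁻¹) = (hZ.1.eigenvectorUnitary : Matrix (Fin n) (Fin n) ℂ) *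
      diagonal (fun i => (f (hZ.1.eigenvalues i) : ℂ)) *
      star (hZ.1.eigenvectorUnitary : Matrix (Fin n) (Fin n) ℂ) := by
    rw [hZ.1.cfc_eq, IsHermitian.cfc, Unitary.conjStarAlgAut_apply]
    rfl
  set U := hZ.1.eigenvectorUnitary
  have hUU : (U : Matrix (Fin n) (Fin n) ℂ) * star (U : Matrix (Fin n) (Fin n) ℂ) = 1 :=
    Unitary.coe_mul_star_self U
  have hUU' : star (U : Matrix (Fin n) (Fin n) ℂ) * (U : Matrix (Fin n) (Fin n) ℂ) = 1 :=
    Unitary.coe_star_mul_self U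
  refine ⟨S * U, star (U : Matrix (Fin n) (Fin n) ℂ) * S, hZ.1.eigenvalues,
    hS.mul (IsUnit.of_mul_eq_one _ hUU), (IsUnit.of_mul_eq_one _ hUU').mul hS,
    hZ.eigenvalues_pos, ?_, ?_, fun μ => ?_⟩
  · rw [mul_assoc, ← mul_assoc (U : Matrix (Fin n) (Fin n) ℂ), hUU, one_mul, hSS]
  · have h := hc id
    rw [cfc_id ℝ _ hZ.1.isSelfAdjoint] at h
    calc X = S * (S⁻¹ * X * S⁻¹) * S := by
          simp only [mul_assoc, nonsing_inv_mul _ hSd, mul_one]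
          rw [← mul_assoc, mul_nonsing_inv _ hSd, one_mul]
      _ = _ := (congrArg (fun M => S * M * S) h).trans (by simp only [mul_assoc, id])
  · rw [kuboAndo, ← hSdef, hc]
    simp only [mul_assoc]

theorem convex_combination_pos {d l : ℝ} (hd : 0 < d) (hl : l ∈ Set.Icc (0 : ℝ) 1) :
    0 < (1 - l) * d + l := by
  rcases hl.1.eq_or_lt with rfl | h0
  · simpa
  · have := mul_nonneg (sub_nonneg.2 hl.2) hd.le
    linarith

theorem kuboAndo_eq_integral (μ : Measure ℝ) [IsProbabilityMeasure μ]
    (hμ01 : μ (Set.Icc (0 : ℝ) 1) = 1) {A X : Matrix (Fin n) (Fin n) ℂ} (hA : A.PosDef)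
    (hX : X.PosDef) :
    kuboAndo μ A X = ∫ l, X * ((1 - l) • X + l • A)⁻¹ * A ∂μ := by
  have hμ := restrict_of_measure_eq_one measurableSet_Icc hμ01
  obtain ⟨P, R, d, hP, hR, hd, hAe, hXe, hk⟩ := kuboAndo_exists_congruence hA hX
  rw [isUnit_iff_isUnit_det] at hP hR
  let L : (Fin n → ℝ) →L[ℝ] Matrix (Fin n) (Fin n) ℂ := LinearMap.toContinuousLinearMap
    { toFun := fun v => P * diagonal (fun i => (v i : ℂ)) * R
      map_add' := fun v w => by
        rw [← add_mul, ← mul_add, diagonal_add]; simp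
      map_smul' := fun c v => by
        have : (diagonal fun i => ((c • v) i : ℂ)) = c • diagonal fun i => (v i : ℂ) := by
          rw [← diagonal_smul]; congr 1; ext i; simp
        rw [this]; simp }
  have hL (v : Fin n → ℝ) : L v = P * diagonal (fun i => (v i : ℂ)) * R := rfl
  have hint (i : Fin n) : Integrable (fun l => d i / ((1 - l) * d i + l)) μ := by
    refine integrable_of_continuousOn isCompact_Icc hμ01 ?_
    exact ContinuousOn.div (by fun_prop) (by fun_prop)
      fun l hl => (convex_combination_pos (hd i) hl).ne'
  have hpt : ∀ l ∈ Set.Icc (0 : ℝ) 1, X * ((1 - l) • X + l • A)⁻¹ * A =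
      L fun i => d i / ((1 - l) * d i + l) := fun l hl => by
    have hQ : (1 - l) • X + l • A =
        P * diagonal (fun i => (((1 - l) * d i + l : ℝ) : ℂ)) * R := by
      have : diagonal (fun i => (((1 - l) * d i + l : ℝ) : ℂ)) =
          (1 - l) • diagonal (fun i => (d i : ℂ)) + l • (1 : Matrix (Fin n) (Fin n) ℂ) := by
        rw [← diagonal_one, ← diagonal_smul, ← diagonal_smul, diagonal_add]
        congr 1; ext i; simp
      rw [this, hAe, hXe]
      simp [mul_add, add_mul]
    have hinv : (diagonal (fun i => (((1 - l) * d i + l : ℝ) : ℂ)))⁻¹ =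
        diagonal (fun i => ((((1 - l) * d i + l)⁻¹ : ℝ) : ℂ)) := by
      refine inv_eq_right_inv ?_
      rw [diagonal_mul_diagonal, ← diagonal_one]
      congr 1; ext i
      rw [← Complex.ofReal_mul, mul_inv_cancel₀ (convex_combination_pos (hd i) hl).ne',
        Complex.ofReal_one]
    rw [hQ, hL, Matrix.mul_inv_rev, Matrix.mul_inv_rev, hinv]
    nth_rw 1 [hXe]
    rw [hAe]
    have h1 (M : Matrix (Fin n) (Fin n) ℂ) : R * (R⁻¹ * M) = M := mul_nonsing_inv_cancel_left _ _ hR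
    have h2 (M : Matrix (Fin n) (Fin n) ℂ) : P⁻¹ * (P * M) = M := nonsing_inv_mul_cancel_left _ _ hP
    simp only [mul_assoc, h1, h2]
    rw [← mul_assoc (diagonal fun i => (d i : ℂ)), diagonal_mul_diagonal]
    simp [div_eq_mul_inv]
  calc kuboAndo μ A X = L (∫ l, (fun i => d i / ((1 - l) * d i + l)) ∂μ) := by
        rw [hk, hL]
        congr 3; ext i
        rw [eval_integral fun i => hint i, fmu]
    _ = ∫ l, L (fun i => d i / ((1 - l) * d i + l)) ∂μ :=
        (L.integral_comp_comm (Integrable.of_eval fun i => hint i)).symm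
    _ = ∫ l in Set.Icc (0 : ℝ) 1, L (fun i => d i / ((1 - l) * d i + l)) ∂μ := by rw [hμ]
    _ = ∫ l in Set.Icc (0 : ℝ) 1, X * ((1 - l) • X + l • A)⁻¹ * A ∂μ :=
        setIntegral_congr_fun measurableSet_Icc fun l hl => (hpt l hl).symm
    _ = _ := by rw [hμ]

attribute [local instance] Matrix.frobeniusNormedRing Matrix.frobeniusNormedAlgebra

theorem hasDerivAt_mul_nonsing_inv_mul {A X Y : Matrix (Fin n) (Fin n) ℂ} {l t : ℝ}
    (hQ : IsUnit ((1 - l) • (X + t • Y) + l • A)) :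
    HasDerivAt (fun s : ℝ => (X + s • Y) * ((1 - l) • (X + s • Y) + l • A)⁻¹ * A)
      (l • (A * ((1 - l) • (X + t • Y) + l • A)⁻¹ * Y *
        (((1 - l) • (X + t • Y) + l • A)⁻¹ * A))) t := by
  have hB : HasDerivAt (fun s : ℝ => X + s • Y) Y t := by
    exact (((hasDerivAt_id t).smul_const Y).const_add X).congr_deriv (one_smul ℝ Y)
  have hC : HasDerivAt (fun s : ℝ => (1 - l) • (X + s • Y) + l • A) ((1 - l) • Y) t :=
    (hB.const_smul (1 - l)).add_const (l • A)
  obtain ⟨u, hu⟩ := hQ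
  have hI := hasFDerivAt_ringInverse (𝕜 := ℝ) u
  rw [hu] at hI
  have hD := hI.comp_hasDerivAt t hC
  have hui : ((u⁻¹ : (Matrix (Fin n) (Fin n) ℂ)ˣ) : Matrix (Fin n) (Fin n) ℂ) =
      ((1 - l) • (X + t • Y) + l • A)⁻¹ := by
    rw [← hu, nonsing_inv_eq_ringInverse, Ring.inverse_unit]
  have hE := (hB.mul hD).mul_const A
  have hG : l • (A * ((1 - l) • (X + t • Y) + l • A)⁻¹) =
      1 - (1 - l) • ((X + t • Y) * ((1 - l) • (X + t • Y) + l • A)⁻¹) := by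
    rw [eq_sub_iff_add_eq, ← smul_mul_assoc, ← smul_mul_assoc, ← add_mul, add_comm (l • A), ← hui,
      ← hu, Units.mul_inv]
  refine (hE.congr_deriv ?_).congr_of_eventuallyEq (.of_forall fun s => ?_)
  · simp only [Function.comp_apply, ← nonsing_inv_eq_ringInverse,
      _root_.neg_apply, ContinuousLinearMap.mulLeftRight_apply, hui]
    rw [mul_assoc _ Y, ← smul_mul_assoc, hG]
    simp only [add_mul, mul_assoc, one_mul, smul_mul_assoc, mul_smul_comm, mul_neg,
      neg_mul, sub_eq_add_neg]
  · simp only [nonsing_inv_eq_ringInverse, Pi.mul_apply, Function.comp_apply]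

theorem nonsing_inv_mul_mul_nonsing_inv_eq {A X Y : Matrix (Fin n) (Fin n) ℂ} (hA : IsUnit A)
    (l : ℝ) :
    ((1 - l) • (X * A⁻¹) + l • (1 : Matrix (Fin n) (Fin n) ℂ))⁻¹ * Y *
        ((1 - l) • (A⁻¹ * X) + l • (1 : Matrix (Fin n) (Fin n) ℂ))⁻¹ =
      A * ((1 - l) • X + l • A)⁻¹ * Y * (((1 - l) • X + l • A)⁻¹ * A) := by
  have hd := (isUnit_iff_isUnit_det _).1 hA
  have h1 : (1 - l) • (X * A⁻¹) + l • 1 = ((1 - l) • X + l • A) * A⁻¹ := by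
    rw [add_mul, smul_mul_assoc, smul_mul_assoc, mul_nonsing_inv _ hd]
  have h2 : (1 - l) • (A⁻¹ * X) + l • 1 = A⁻¹ * ((1 - l) • X + l • A) := by
    rw [mul_add, mul_smul_comm, mul_smul_comm, nonsing_inv_mul _ hd]
  rw [h1, h2, Matrix.mul_inv_rev, Matrix.mul_inv_rev, nonsing_inv_nonsing_inv _ hd]

theorem continuousOn_nonsing_inv {α : Type*} [TopologicalSpace α] {s : Set α}
    {Q : α → Matrix (Fin n) (Fin n) ℂ} (hc : ContinuousOn Q s) (hQ : ∀ a ∈ s, IsUnit (Q a)) :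
    ContinuousOn (fun a => (Q a)⁻¹) s := fun a ha =>
  (continuousAt_matrix_inv _ (NormedRing.inverse_continuousAt
    ((isUnit_iff_isUnit_det _).1 (hQ a ha)).unit)).comp_continuousWithinAt (hc a ha)

end

/-- For `F_{μ,A}(X) = A σ_μ X`, the Fréchet derivative at a positive definite
`X` in a Hermitian direction `Y` is
`∫ λ ((1-λ)XA⁻¹ + λI)⁻¹ Y ((1-λ)A⁻¹X + λI)⁻¹ dμ(λ)`. -/
theorem kuboAndo_deriv {n : ℕ} (μ : Measure ℝ) [IsProbabilityMeasure μ]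
    (hμ01 : μ (Set.Icc (0 : ℝ) 1) = 1)
    (A X Y : Matrix (Fin n) (Fin n) ℂ) (hA : A.PosDef) (hX : X.PosDef) (hY : Y.IsHermitian) :
    HasDerivAt (fun t : ℝ => kuboAndo μ A (X + t • Y))
      (∫ l, l • (((1 - l) • (X * A⁻¹) + l • (1 : Matrix (Fin n) (Fin n) ℂ))⁻¹ * Y *
        ((1 - l) • (A⁻¹ * X) + l • (1 : Matrix (Fin n) (Fin n) ℂ))⁻¹) ∂μ) 0 := by
  have hpos := hX.eventually_add_smul hY
  obtain ⟨δ, hδ, hball⟩ := Metric.nhds_basis_closedBall.mem_iff.1 hpos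
  have hQ (t : ℝ) (ht : t ∈ Metric.closedBall (0 : ℝ) δ) (l : ℝ) (hl : l ∈ Set.Icc (0 : ℝ) 1) :
      IsUnit ((1 - l) • (X + t • Y) + l • A) :=
    (PosDef.convex_combination (hball ht) hA hl).isUnit
  have hcQ : ContinuousOn (fun p : ℝ × ℝ => ((1 - p.2) • (X + p.1 • Y) + p.2 • A)⁻¹)
      (Metric.closedBall (0 : ℝ) δ ×ˢ Set.Icc (0 : ℝ) 1) :=
    continuousOn_nonsing_inv (Continuous.continuousOn (by fun_prop))
      fun p hp => hQ p.1 hp.1 p.2 hp.2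
  have main := hasDerivAt_integral_of_continuousOn isCompact_Icc hμ01
    (F := fun t l => (X + t • Y) * ((1 - l) • (X + t • Y) + l • A)⁻¹ * A)
    (F' := fun t l => l • (A * ((1 - l) • (X + t • Y) + l • A)⁻¹ * Y *
        (((1 - l) • (X + t • Y) + l • A)⁻¹ * A))) hδ
    (by unfold Function.uncurry; fun_prop) (by unfold Function.uncurry; fun_prop)
    fun t ht l hl => hasDerivAt_mul_nonsing_inv_mul (hQ t ht l hl)
  simp only [nonsing_inv_mul_mul_nonsing_inv_eq hA.isUnit]
  simp only [zero_smul, add_zero] at main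
  exact main.congr_of_eventuallyEq (hpos.mono fun t ht => kuboAndo_eq_integral μ hμ01 hA ht)
end

section
/- Let μ be a Borel probability measure on [0,1] whose support is not contained in {0,1}, let A₁, …, A_m be diagonal positive definite n×n complex matrices, and let w₁, …, w_m be positive reals with Σ_j w_j = 1. Then the unique minimizer X₀ of X ↦ Σ_{j=1}^m w_j φ_μ(A_j, X) over positive definite n×n complex matrices is also a diagonal matrix. -/
open MeasureTheory Matrix
open scoped ComplexOrder

namespace Matrix

variable {ι : Type*} [Fintype ι] [DecidableEq ι]

theorem IsHermitian.cfc_apply_eq_sum {Y : Matrix ι ι ℂ} (hY : Y.IsHermitian) (f : ℝ → ℝ)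
    (i j : ι) :
    cfc f Y i j = ∑ k, (hY.eigenvectorUnitary : Matrix ι ι ℂ) i k * (f (hY.eigenvalues k) : ℂ) *
      star ((hY.eigenvectorUnitary : Matrix ι ι ℂ) j k) := by
  rw [hY.cfc_eq, IsHermitian.cfc, Unitary.conjStarAlgAut_apply, mul_apply]
  simp [mul_diagonal, star_apply]

theorem IsHermitian.apply_eq_sum {Y : Matrix ι ι ℂ} (hY : Y.IsHermitian) (i j : ι) :
    Y i j = ∑ k, (hY.eigenvectorUnitary : Matrix ι ι ℂ) i k * (hY.eigenvalues k : ℂ) *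
      star ((hY.eigenvectorUnitary : Matrix ι ι ℂ) j k) := by
  have h := hY.cfc_apply_eq_sum id i j
  rwa [cfc_id ℝ Y hY.isSelfAdjoint] at h

theorem IsHermitian.sum_eigenvectorUnitary_mul_star {Y : Matrix ι ι ℂ} (hY : Y.IsHermitian)
    (i j : ι) :
    ∑ k, (hY.eigenvectorUnitary : Matrix ι ι ℂ) i k *
      star ((hY.eigenvectorUnitary : Matrix ι ι ℂ) j k) = (1 : Matrix ι ι ℂ) i j := by
  have h := congrFun (congrFun (Unitary.coe_mul_star_self hY.eigenvectorUnitary) i) j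
  simpa [mul_apply, star_apply] using h

theorem IsHermitian.sum_normSq_eigenvectorUnitary {Y : Matrix ι ι ℂ} (hY : Y.IsHermitian)
    (i : ι) : ∑ k, Complex.normSq ((hY.eigenvectorUnitary : Matrix ι ι ℂ) i k) = 1 := by
  have h := hY.sum_eigenvectorUnitary_mul_star i i
  simp only [Complex.star_def, Complex.mul_conj, one_apply_eq] at h
  exact_mod_cast h

theorem IsHermitian.cfc_apply_self {Y : Matrix ι ι ℂ} (hY : Y.IsHermitian) (f : ℝ → ℝ) (i : ι) :
    (cfc f Y i i).re = ∑ k, Complex.normSq ((hY.eigenvectorUnitary : Matrix ι ι ℂ) i k) *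
      f (hY.eigenvalues k) := by
  rw [hY.cfc_apply_eq_sum, Complex.re_sum]
  refine Finset.sum_congr rfl fun k _ ↦ ?_
  rw [mul_right_comm, Complex.star_def, Complex.mul_conj, Complex.re_mul_ofReal,
    Complex.ofReal_re]

theorem cfc_diagonal (f : ℝ → ℝ) (d : ι → ℝ) :
    cfc f (diagonal fun i ↦ (d i : ℂ)) = diagonal fun i ↦ (f (d i) : ℂ) := by
  set Y : Matrix ι ι ℂ := diagonal fun i ↦ (d i : ℂ)
  have hY : Y.IsHermitian := by
    refine isHermitian_diagonal_of_self_adjoint _ (funext fun i ↦ ?_)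
    simp
  set U : Matrix ι ι ℂ := (hY.eigenvectorUnitary : Matrix ι ι ℂ)
  have key : ∀ i k, U i k ≠ 0 → hY.eigenvalues k = d i := by
    intro i k hik
    have h := congrFun (hY.mulVec_eigenvectorBasis k) i
    have hdiag (v : ι → ℂ) : (Y *ᵥ v) i = (d i : ℂ) * v i := mulVec_diagonal _ _ _
    rw [hdiag] at h
    have hb : (hY.eigenvectorBasis k).ofLp i = U i k := (hY.eigenvectorUnitary_apply i k).symm
    rw [hb] at h
    simp only [Pi.smul_apply, hb, Complex.real_smul] at h
    exact_mod_cast (mul_right_cancel₀ hik h).symm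
  ext i j
  rw [hY.cfc_apply_eq_sum]
  have : ∀ k ∈ Finset.univ, U i k * (f (hY.eigenvalues k) : ℂ) * star (U j k)
      = (f (d i) : ℂ) * (U i k * star (U j k)) := by
    intro k _
    by_cases hik : U i k = 0
    · simp [hik]
    · rw [key i k hik]; ring
  rw [Finset.sum_congr rfl this, ← Finset.mul_sum, hY.sum_eigenvectorUnitary_mul_star]
  simp [diagonal_apply, one_apply]

theorem IsHermitian.cfc_apply_self_le {Y : Matrix ι ι ℂ} (hY : Y.IsHermitian) {s : Set ℝ}
    {f : ℝ → ℝ} (hf : ConcaveOn ℝ s f) (hs : ∀ k, hY.eigenvalues k ∈ s) (i : ι) :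
    (cfc f Y i i).re ≤ f (Y i i).re := by
  have hid := hY.cfc_apply_self id i
  rw [cfc_id ℝ Y hY.isSelfAdjoint] at hid
  rw [hid, hY.cfc_apply_self]
  exact hf.le_map_sum (fun k _ ↦ Complex.normSq_nonneg _) (hY.sum_normSq_eigenvectorUnitary i)
    fun k _ ↦ hs k

theorem IsHermitian.apply_eq_zero_of_cfc_apply_self_eq {Y : Matrix ι ι ℂ} (hY : Y.IsHermitian)
    {s : Set ℝ} {f : ℝ → ℝ} (hf : StrictConcaveOn ℝ s f) (hs : ∀ k, hY.eigenvalues k ∈ s) {i j : ι}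
    (h : (cfc f Y i i).re = f (Y i i).re) (hij : i ≠ j) : Y i j = 0 := by
  have hid := hY.cfc_apply_self id i
  rw [cfc_id ℝ Y hY.isSelfAdjoint] at hid
  rw [hid, hY.cfc_apply_self] at h
  have hk := (hf.map_sum_eq_iff' (t := Finset.univ) (fun k _ ↦ Complex.normSq_nonneg _)
    (hY.sum_normSq_eigenvectorUnitary i) fun k _ ↦ hs k).1 h.symm
  rw [hY.apply_eq_sum]
  set U : Matrix ι ι ℂ := (hY.eigenvectorUnitary : Matrix ι ι ℂ)
  have : ∀ k ∈ Finset.univ, U i k * (hY.eigenvalues k : ℂ) * star (U j k)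
      = ((Y i i).re : ℂ) * (U i k * star (U j k)) := by
    intro k _
    by_cases hik : U i k = 0
    · simp [hik]
    · have h1 := hk k (Finset.mem_univ k) (by simpa using hik)
      have h2 : hY.eigenvalues k = (Y i i).re := by rw [hid]; exact h1
      rw [h2]; ring
  rw [Finset.sum_congr rfl this, ← Finset.mul_sum, hY.sum_eigenvectorUnitary_mul_star,
    one_apply_ne hij, mul_zero]

end Matrix

theorem weighted_harmonic_mean_denom_pos {l x : ℝ} (hl : l ∈ Set.Icc (0 : ℝ) 1) (hx : 0 < x) :
    0 < (1 - l) * x + l := by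
  obtain ⟨h0, h1⟩ := hl
  rcases h1.lt_or_eq with h | rfl
  · have := mul_pos (sub_pos.2 h) hx
    linarith
  · simp

theorem integrable_weighted_harmonic_mean {μ : Measure ℝ} [IsFiniteMeasure μ]
    (hμ : ∀ᵐ l ∂μ, l ∈ Set.Icc (0 : ℝ) 1) {x : ℝ} (hx : 0 < x) :
    Integrable (fun l ↦ x / ((1 - l) * x + l)) μ := by
  refine Integrable.of_bound (C := max 1 x) ?_ ?_
  · exact (by fun_prop : Measurable fun l : ℝ ↦ x / ((1 - l) * x + l)).aestronglyMeasurable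
  · filter_upwards [hμ] with l hl
    have hp := weighted_harmonic_mean_denom_pos hl hx
    rw [Real.norm_of_nonneg (by positivity), div_le_iff₀ hp]
    obtain ⟨h0, h1⟩ := hl
    rcases le_total x 1 with h | h
    · rw [max_eq_left h]; nlinarith
    · rw [max_eq_right h]
      nlinarith [mul_nonneg (mul_nonneg (sub_nonneg.2 h1) hx.le) (sub_nonneg.2 h)]

theorem weighted_harmonic_mean_concavity_gap {l x y a b : ℝ} (hl : l ∈ Set.Icc (0 : ℝ) 1)
    (hx : 0 < x) (hy : 0 < y) (ha : 0 < a) (hb : 0 < b) (hab : a + b = 1) :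
    (a * x + b * y) / ((1 - l) * (a * x + b * y) + l) -
        (a * (x / ((1 - l) * x + l)) + b * (y / ((1 - l) * y + l))) =
      l * (1 - l) * (a * b * (x - y) ^ 2) / (((1 - l) * x + l) * ((1 - l) * y + l) *
        ((1 - l) * (a * x + b * y) + l)) := by
  have hp := (weighted_harmonic_mean_denom_pos hl hx).ne'
  have hq := (weighted_harmonic_mean_denom_pos hl hy).ne'
  have hr := (weighted_harmonic_mean_denom_pos hl
    (by positivity : 0 < a * x + b * y)).ne'
  obtain rfl : b = 1 - a := by linarith
  rw [mul_div_assoc', mul_div_assoc', div_add_div _ _ hp hq,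
    div_sub_div _ _ hr (mul_ne_zero hp hq),
    div_eq_div_iff (mul_ne_zero hr (mul_ne_zero hp hq)) (mul_ne_zero (mul_ne_zero hp hq) hr)]
  ring

theorem strictConcaveOn_fmu {μ : Measure ℝ} [IsFiniteMeasure μ]
    (hμ : ∀ᵐ l ∂μ, l ∈ Set.Icc (0 : ℝ) 1) (hsupp : μ ({0, 1} : Set ℝ)ᶜ ≠ 0) :
    StrictConcaveOn ℝ (Set.Ioi 0) (fmu μ) := by
  refine ⟨convex_Ioi 0, fun x hx y hy hxy a b ha hb hab ↦ ?_⟩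
  rw [Set.mem_Ioi] at hx hy
  have hxy0 : 0 < a * x + b * y := by positivity
  have hxy2 : 0 < (x - y) ^ 2 := by have := sub_ne_zero.2 hxy; positivity
  simp only [smul_eq_mul, fmu]
  have hxI := (integrable_weighted_harmonic_mean hμ hx).const_mul a
  have hyI := (integrable_weighted_harmonic_mean hμ hy).const_mul b
  have hsI : Integrable (fun l ↦ a * (x / ((1 - l) * x + l)) + b * (y / ((1 - l) * y + l))) μ :=
    hxI.add hyI
  have hzI := integrable_weighted_harmonic_mean hμ hxy0
  rw [← integral_const_mul, ← integral_const_mul, ← integral_add hxI hyI, ← sub_pos,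
    ← integral_sub hzI hsI]
  refine (integral_pos_iff_support_of_nonneg_ae ?nonneg (hzI.sub hsI)).2 (pos_iff_ne_zero.2 ?pos)
  case pos =>
    refine fun h0 ↦ hsupp (measure_mono_null_ae ?_ h0)
    filter_upwards [hμ] with l hl hl01
    replace hl01 : l ∉ ({0, 1} : Set ℝ) := hl01
    have hne : l ≠ 0 ∧ l ≠ 1 := by simpa [not_or] using hl01
    have h1 : 0 < l := lt_of_le_of_ne hl.1 hne.1.symm
    have h2 : 0 < 1 - l := sub_pos.2 (lt_of_le_of_ne hl.2 hne.2)
    have hp := weighted_harmonic_mean_denom_pos hl hx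
    have hq := weighted_harmonic_mean_denom_pos hl hy
    have hr := weighted_harmonic_mean_denom_pos hl hxy0
    refine Function.mem_support.2 (ne_of_gt ?_)
    rw [Pi.sub_apply]
    rw [weighted_harmonic_mean_concavity_gap hl hx hy ha hb hab]
    positivity
  case nonneg =>
    filter_upwards [hμ] with l hl
    have hp := weighted_harmonic_mean_denom_pos hl hx
    have hq := weighted_harmonic_mean_denom_pos hl hy
    have hr := weighted_harmonic_mean_denom_pos hl hxy0
    have h1 := hl.1
    have h2 := sub_nonneg.2 hl.2
    simp only [Pi.zero_apply, Pi.sub_apply]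
    rw [weighted_harmonic_mean_concavity_gap hl hx hy ha hb hab]
    positivity

theorem matSqrt_diagonal {n : ℕ} (a : Fin n → ℝ) :
    matSqrt (diagonal fun i ↦ (a i : ℂ)) = diagonal fun i ↦ (√(a i) : ℂ) :=
  cfc_diagonal _ _

theorem matSqrt_diagonal_inv {n : ℕ} {a : Fin n → ℝ} (ha : ∀ i, 0 < a i) :
    (matSqrt (diagonal fun i ↦ (a i : ℂ)))⁻¹ = diagonal fun i ↦ ((√(a i))⁻¹ : ℂ) := by
  rw [matSqrt_diagonal]
  refine inv_eq_right_inv ?_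
  rw [diagonal_mul_diagonal, ← diagonal_one]
  congr 1
  funext i
  exact mul_inv_cancel₀ (by exact_mod_cast (Real.sqrt_pos.2 (ha i)).ne')

/-- The matrix `A^{-1/2} X A^{-1/2}` for `A` diagonal with positive diagonal `a`. -/
noncomputable def diagCongr {n : ℕ} (a : Fin n → ℝ) (X : Matrix (Fin n) (Fin n) ℂ) :
    Matrix (Fin n) (Fin n) ℂ :=
  (diagonal fun i ↦ ((√(a i))⁻¹ : ℂ)) * X * diagonal fun i ↦ ((√(a i))⁻¹ : ℂ)

theorem diagCongr_apply {n : ℕ} (a : Fin n → ℝ) (X : Matrix (Fin n) (Fin n) ℂ) (i j : Fin n) :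
    diagCongr a X i j = ((√(a i))⁻¹ : ℂ) * X i j * ((√(a j))⁻¹ : ℂ) := by
  rw [diagCongr, mul_diagonal, diagonal_mul]

theorem posDef_diagCongr {n : ℕ} {a : Fin n → ℝ} (ha : ∀ i, 0 < a i)
    {X : Matrix (Fin n) (Fin n) ℂ} (hX : X.PosDef) : (diagCongr a X).PosDef := by
  have hD : (diagonal fun i ↦ ((√(a i))⁻¹ : ℂ)).PosDef := .diagonal fun i ↦ by
    have := Real.sqrt_pos.2 (ha i)
    rw [← Complex.ofReal_inv]
    exact_mod_cast inv_pos.2 this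
  have h := hX.conjTranspose_mul_mul_same (mulVec_injective_of_isUnit hD.isUnit)
  rwa [hD.isHermitian.eq] at h

theorem re_trace_kuboAndo_diagonal {n : ℕ} (μ : Measure ℝ) {a : Fin n → ℝ} (ha : ∀ i, 0 < a i)
    (X : Matrix (Fin n) (Fin n) ℂ) :
    (kuboAndo μ (diagonal fun i ↦ (a i : ℂ)) X).trace.re =
      ∑ i, a i * (cfc (fmu μ) (diagCongr a X) i i).re := by
  rw [kuboAndo, matSqrt_diagonal_inv ha, matSqrt_diagonal, trace, Complex.re_sum]
  refine Finset.sum_congr rfl fun i _ ↦ ?_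
  rw [diag_apply, mul_diagonal, diagonal_mul, mul_right_comm, ← Complex.ofReal_mul,
    Real.mul_self_sqrt (ha i).le, Complex.re_ofReal_mul]
  rfl

theorem re_trace_kuboAndo_lt_pinching {n : ℕ} {μ : Measure ℝ}
    (hf : StrictConcaveOn ℝ (Set.Ioi 0) (fmu μ)) {a : Fin n → ℝ} (ha : ∀ i, 0 < a i)
    {X : Matrix (Fin n) (Fin n) ℂ} (hX : X.PosDef) (hXd : ¬ X.IsDiag) :
    (kuboAndo μ (diagonal fun i ↦ (a i : ℂ)) X).trace.re <
      (kuboAndo μ (diagonal fun i ↦ (a i : ℂ)) (diagonal X.diag)).trace.re := by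
  have hY := posDef_diagCongr ha hX
  have hreal (i : Fin n) : ((diagCongr a X i i).re : ℂ) = diagCongr a X i i :=
    hY.isHermitian.coe_re_apply_self i
  have hD : diagCongr a (diagonal X.diag) =
      diagonal fun i ↦ ((diagCongr a X i i).re : ℂ) := by
    ext i j
    rw [diagCongr_apply]
    rcases eq_or_ne i j with rfl | hij
    · rw [diagonal_apply_eq, diagonal_apply_eq, hreal, diagCongr_apply, diag_apply]
    · simp [hij]
  rw [re_trace_kuboAndo_diagonal μ ha, re_trace_kuboAndo_diagonal μ ha, hD, cfc_diagonal]
  simp only [diagonal_apply_eq, Complex.ofReal_re]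
  have hle (i : Fin n) : (cfc (fmu μ) (diagCongr a X) i i).re ≤ fmu μ (diagCongr a X i i).re :=
    hY.isHermitian.cfc_apply_self_le hf.concaveOn (fun k ↦ hY.eigenvalues_pos k) i
  obtain ⟨i, j, hij, hne⟩ : ∃ i j, i ≠ j ∧ X i j ≠ 0 := by
    simpa [IsDiag, Pairwise] using hXd
  refine Finset.sum_lt_sum (fun i _ ↦ mul_le_mul_of_nonneg_left (hle i) (ha i).le)
    ⟨i, Finset.mem_univ i, mul_lt_mul_of_pos_left ((hle i).lt_of_ne fun heq ↦ hne ?_) (ha i)⟩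
  have h0 := hY.isHermitian.apply_eq_zero_of_cfc_apply_self_eq hf
    (fun k ↦ hY.eigenvalues_pos k) heq hij
  simpa [diagCongr_apply, (Real.sqrt_pos.2 (ha i)).ne', (Real.sqrt_pos.2 (ha j)).ne'] using h0

theorem qhd_pinching_lt {n : ℕ} {μ : Measure ℝ} (hf : StrictConcaveOn ℝ (Set.Ioi 0) (fmu μ))
    {A X : Matrix (Fin n) (Fin n) ℂ} (hA : A.PosDef) (hAd : A.IsDiag) (hX : X.PosDef)
    (hXd : ¬ X.IsDiag) : qhd μ A (diagonal X.diag) < qhd μ A X := by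
  obtain ⟨a, rfl⟩ : ∃ a : Fin n → ℝ, A = diagonal fun i ↦ (a i : ℂ) :=
    ⟨fun i ↦ (A i i).re, by
      rw [← hAd.diagonal_diag]
      congr 1
      funext i
      simpa using (hA.isHermitian.coe_re_apply_self i).symm⟩
  have ha : ∀ i, 0 < a i := fun i ↦ by exact_mod_cast posDef_diagonal_iff.1 hA i
  have h := re_trace_kuboAndo_lt_pinching hf ha hX hXd
  have ht : (diagonal X.diag).trace = X.trace := by simp [trace]
  simp only [qhd, trace_sub, trace_add, trace_smul, Complex.sub_re, ht]
  linarith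

/-- If all the `A_j` are diagonal positive definite matrices, then the unique
minimizer of `X ↦ Σ_j w_j φ_μ(A_j, X)` over positive definite matrices is also diagonal. -/
theorem qhd_barycenter_of_diagonal_isDiag {n m : ℕ} (μ : Measure ℝ) [IsProbabilityMeasure μ]
    (hμ01 : μ (Set.Icc (0 : ℝ) 1) = 1) (hsupp : μ ({0, 1} : Set ℝ)ᶜ ≠ 0)
    (A : Fin m → Matrix (Fin n) (Fin n) ℂ) (hA : ∀ j, (A j).PosDef)
    (hAdiag : ∀ j, (A j).IsDiag)
    (w : Fin m → ℝ) (hw : ∀ j, 0 < w j) (hw1 : ∑ j, w j = 1)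
    (X₀ : Matrix (Fin n) (Fin n) ℂ) (hX₀ : X₀.PosDef)
    (hmin : ∀ X : Matrix (Fin n) (Fin n) ℂ, X.PosDef →
      ∑ j, w j * qhd μ (A j) X₀ ≤ ∑ j, w j * qhd μ (A j) X) :
    X₀.IsDiag := by
  have hμ : ∀ᵐ l ∂μ, l ∈ Set.Icc (0 : ℝ) 1 :=
    (mem_ae_iff_prob_eq_one measurableSet_Icc).2 hμ01
  have hf := strictConcaveOn_fmu hμ hsupp
  by_contra hXd
  have hm : (Finset.univ : Finset (Fin m)).Nonempty := by
    rw [Finset.nonempty_iff_ne_empty]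
    intro h
    simp [h] at hw1
  have hD : (diagonal X₀.diag).PosDef := .diagonal fun i ↦ hX₀.diag_pos
  exact (hmin _ hD).not_gt <| Finset.sum_lt_sum_of_nonempty hm fun j _ ↦
    mul_lt_mul_of_pos_left (qhd_pinching_lt hf (hA j) (hAdiag j) hX₀ hXd) (hw j)
end
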